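/- Let G be a finite group with |G| > 2. Then there exists no multiplicity-free extension R of G by a two-element set T = {t₁, t₂} in which G stabilizes every element of T (i.e. G^l_t = G for all t ∈ T). -/

import Mathlib

/-- A fusion ring, given by its finite basis `B`, unit, involution (dual) and
structure constants `N a b c` (the coefficient of `c` in `a × b`). -/
structure FusionData (B : Type*) [Fintype B] [DecidableEq B] where
  one : B
  dual : B → B
  N : B → B → B → ℕ
  dual_dual : ∀ a, dual (dual a) = a
  N_one_left : ∀ a c, N one a c = if a = c then 1 else 0
  N_one_right : ∀ a c, N a one c = if a = c then 1 else 0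
  assoc : ∀ a b c d, ∑ e, N a b e * N e c d = ∑ f, N b c f * N a f d
  dual_pair : ∀ a b, N a (dual b) one = if a = b then 1 else 0
  frob : ∀ a b c, N a b c = N (dual a) c b

/-- An extension of a finite group `G` by a finite set `T`: a fusion ring with
basis `G ⊔ T`, unit `1 ∈ G`, whose structure constants restrict to the group
multiplication on `G`. -/
structure GroupExt (G T : Type*) [Group G] [Fintype G] [DecidableEq G]
    [Fintype T] [DecidableEq T] extends FusionData (G ⊕ T) where
  one_def : one = Sum.inl 1
  mul_def : ∀ g h k : G, N (Sum.inl g) (Sum.inl h) (Sum.inl k) = if g * h = k then 1 else 0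
  mul_t : ∀ (g h : G) (t : T), N (Sum.inl g) (Sum.inl h) (Sum.inr t) = 0

namespace FusionData

variable {B : Type*} [Fintype B] [DecidableEq B] (F : FusionData B)

/-- Cyclic invariance of the structure constants. -/
lemma N_cyclic (a b c : B) : F.N a b c = F.N b (F.dual c) (F.dual a) := by
  have h := F.assoc a b (F.dual c) F.one
  have hL : ∀ e, F.N e (F.dual c) F.one = if e = c then 1 else 0 := fun e => F.dual_pair e c
  have hR : ∀ f, F.N a f F.one = if F.dual a = f then 1 else 0 := by
    intro f
    have := F.dual_pair a (F.dual f)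
    rw [F.dual_dual] at this
    rw [this]
    refine if_congr ⟨fun h => ?_, fun h => ?_⟩ rfl rfl
    · rw [h, F.dual_dual]
    · rw [← h, F.dual_dual]
  simpa [hL, hR] using h

end FusionData

namespace GroupExt

variable {G T : Type*} [Group G] [Fintype G] [DecidableEq G] [Fintype T] [DecidableEq T]
  (E : GroupExt G T)

lemma dual_inl (g : G) : E.dual (Sum.inl g) = Sum.inl g⁻¹ := by
  have h := E.dual_pair (Sum.inl g⁻¹) (E.dual (Sum.inl g))
  rw [E.dual_dual, E.one_def, E.mul_def] at h
  by_contra hne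
  simp [Ne.symm hne] at h

lemma exists_dual_inr (t : T) : ∃ s, E.dual (Sum.inr t) = Sum.inr s := by
  rcases h : E.dual (Sum.inr t) with g | s
  · have h' := E.dual_dual (Sum.inr t)
    rw [h, E.dual_inl] at h'
    cases h'
  · exact ⟨s, rfl⟩

/-- If `G` fixes every element of `T`, then `g × t` contains no other element of `T`. -/
lemma N_inl_inr_inr_of_ne (hst : ∀ (g : G) (t : T), E.N (Sum.inl g) (Sum.inr t) (Sum.inr t) ≠ 0)
    (g : G) {t s : T} (hts : t ≠ s) : E.N (Sum.inl g) (Sum.inr t) (Sum.inr s) = 0 := by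
  have h := E.assoc (Sum.inl g⁻¹) (Sum.inl g) (Sum.inr t) (Sum.inr s)
  have hone : E.N (Sum.inl 1) (Sum.inr t) (Sum.inr s) = 0 := by
    rw [← E.one_def, E.N_one_left]
    simp [hts]
  have hL : ∑ e, E.N (Sum.inl g⁻¹) (Sum.inl g) e * E.N e (Sum.inr t) (Sum.inr s) = 0 := by
    simp [Fintype.sum_sum_type, E.mul_def, E.mul_t, hone]
  rw [hL, eq_comm, Finset.sum_eq_zero_iff] at h
  exact (mul_eq_zero.mp (h (Sum.inr s) (Finset.mem_univ _))).resolve_right (hst g⁻¹ s)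

end GroupExt

/-- If `|G| > 2` then there is no multiplicity-free extension of `G`
by a two-element set `T` in which `G` stabilizes every element of `T`. -/
theorem no_multfree_two_particle_full_stab {G T : Type*} [Group G] [Fintype G] [DecidableEq G]
    [Fintype T] [DecidableEq T] [Nonempty T]
    (hG : 2 < Fintype.card G) (hT : Fintype.card T = 2) :
    ¬ ∃ E : GroupExt G T,
        (∀ a b c : G ⊕ T, E.N a b c ≤ 1) ∧
        (∀ (g : G) (t : T), E.N (Sum.inl g) (Sum.inr t) (Sum.inr t) ≠ 0) := by
  rintro ⟨E, hmf, hst⟩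
  obtain ⟨a, s, has⟩ := Fintype.one_lt_card_iff.mp (show 1 < Fintype.card T by omega)
  obtain ⟨a', ha'⟩ := E.exists_dual_inr a
  obtain ⟨s', hs'⟩ := E.exists_dual_inr s
  have hne : s' ≠ a' := by
    rintro rfl
    have h := E.dual_dual (Sum.inr a)
    rw [ha', ← hs', E.dual_dual] at h
    exact has (Sum.inr_injective h).symm
  have hdual (g : G) : E.N (Sum.inr a) (Sum.inr a') (Sum.inl g) ≠ 0 := by
    have h := E.N_cyclic (Sum.inl g⁻¹) (Sum.inr a) (Sum.inr a)
    rw [ha', E.dual_inl, inv_inv] at h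
    exact h ▸ hst g⁻¹ a
  have hzero (g : G) : E.N (Sum.inr a') (Sum.inr s) (Sum.inl g) = 0 := by
    rw [← ha', E.frob, E.dual_dual, E.N_cyclic, hs', ha', E.N_inl_inr_inr_of_ne hst g hne]
  -- Compare the coefficient of `s` in `(a × ā) × s` and in `a × (ā × s)`.
  have h := E.assoc (Sum.inr a) (Sum.inr a') (Sum.inr s) (Sum.inr s)
  simp only [Fintype.sum_sum_type, hzero, zero_mul, Finset.sum_const_zero, zero_add] at h
  have hlower : Fintype.card G ≤ ∑ g : G, E.N (Sum.inr a) (Sum.inr a') (Sum.inl g) *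
      E.N (Sum.inl g) (Sum.inr s) (Sum.inr s) := by
    simpa using Finset.card_nsmul_le_sum Finset.univ _ 1 fun g _ =>
      Nat.one_le_iff_ne_zero.mpr (mul_ne_zero (hdual g) (hst g s))
  have hupper : ∑ t : T, E.N (Sum.inr a') (Sum.inr s) (Sum.inr t) *
      E.N (Sum.inr a) (Sum.inr t) (Sum.inr s) ≤ Fintype.card T := by
    simpa using Finset.sum_le_card_nsmul Finset.univ _ 1 fun t _ =>
      Nat.mul_le_mul (hmf (Sum.inr a') (Sum.inr s) (Sum.inr t))
        (hmf (Sum.inr a) (Sum.inr t) (Sum.inr s))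
  omega
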